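/- arXiv:2411.19110 — 2 statements merged into one kernel-verified Lean document; each statement's English description precedes it below -/
import Mathlib

section
/- Let G be a graph maximizing the spectral radius among gem-free graphs with m ≥ 7 edges, no isolated vertices, and G ≇ S_{(m+3)/2,2}, and let u be a vertex with maximum Perron-eigenvector entry. Then no vertex of V(G) \ {u} is a cut vertex of G; consequently every vertex v ∉ N[u] has degree at least 2. -/
open scoped Classical
open SimpleGraph Matrix

def ContainsCopy {α β : Type*} (H : SimpleGraph α) (G : SimpleGraph β) : Prop :=
  ∃ f : α ↪ β, ∀ a b, H.Adj a b → G.Adj (f a) (f b)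

def gem : SimpleGraph (Fin 5) :=
  SimpleGraph.fromRel (fun a b => (b.val = a.val + 1 ∧ b.val ≤ 3) ∨ b = 4)

def bookS (k : ℕ) : SimpleGraph (Fin 2 ⊕ Fin k) :=
  SimpleGraph.fromRel (fun a _ => a.isLeft = true)

def pendantS (s t : ℕ) : SimpleGraph (Fin 2 ⊕ (Fin s ⊕ Fin t)) :=
  SimpleGraph.fromRel (fun a b =>
    match a, b with
    | Sum.inl _, Sum.inl _ => True
    | Sum.inl _, Sum.inr (Sum.inl _) => True
    | Sum.inl i, Sum.inr (Sum.inr _) => i = 0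
    | _, _ => False)

def starG (r : ℕ) : SimpleGraph (Fin (r + 1)) :=
  SimpleGraph.fromRel (fun a _ => a = 0)

noncomputable def specRad {V : Type*} [Fintype V] (G : SimpleGraph V) : ℝ :=
  sSup {μ : ℝ | Module.End.HasEigenvalue (Matrix.mulVecLin (G.adjMatrix ℝ)) μ}

noncomputable def edgeCount {V : Type*} [Fintype V] (G : SimpleGraph V) : ℕ :=
  G.edgeFinset.card

noncomputable def edgesIn {V : Type*} [Fintype V] (G : SimpleGraph V) (S : Finset V) : ℕ :=
  (G.edgeFinset.filter (fun e => ∀ v ∈ e, v ∈ S)).card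

noncomputable def N0 {V : Type*} [Fintype V] (G : SimpleGraph V) (u : V) : Finset V :=
  (G.neighborFinset u).filter (fun v => ∀ w ∈ G.neighborFinset u, ¬ G.Adj v w)

noncomputable def Nplus {V : Type*} [Fintype V] (G : SimpleGraph V) (u : V) : Finset V :=
  G.neighborFinset u \ N0 G u

noncomputable def Wset {V : Type*} [Fintype V] (G : SimpleGraph V) (u : V) : Finset V :=
  Finset.univ \ insert u (G.neighborFinset u)

def InFamily (m : ℕ) {V : Type*} [Fintype V] (G : SimpleGraph V) : Prop :=
  ¬ ContainsCopy gem G ∧ edgeCount G = m ∧ (∀ v : V, ∃ w, G.Adj v w) ∧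
    ¬ Nonempty (G ≃g bookS ((m - 1) / 2))

def MaxInFamily (m : ℕ) {V : Type*} [Fintype V] (G : SimpleGraph V) : Prop :=
  InFamily m G ∧ ∀ (n : ℕ) (H : SimpleGraph (Fin n)), InFamily m H → specRad H ≤ specRad G

def IsCutVertex {V : Type*} (G : SimpleGraph V) (v : V) : Prop :=
  ∃ a b : {x : V // x ≠ v}, G.Reachable a.1 b.1 ∧
    ¬ (G.induce {x : V | x ≠ v}).Reachable a b

section Spectral

variable {V W : Type*} [Fintype V] [Fintype W]

theorem le_specRad {G : SimpleGraph V} {μ : ℝ}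
    (h : Module.End.HasEigenvalue (Matrix.mulVecLin (G.adjMatrix ℝ)) μ) : μ ≤ specRad G :=
  le_csSup (Set.Finite.bddAbove (Module.End.finite_hasEigenvalue _)) h

/-- The Rayleigh quotient is bounded by the spectral radius. -/
theorem dotProduct_adjMatrix_mulVec_le (G : SimpleGraph V) (y : V → ℝ) :
    y ⬝ᵥ (G.adjMatrix ℝ *ᵥ y) ≤ specRad G * (y ⬝ᵥ y) := by
  set B : Matrix V V ℝ := specRad G • (1 : Matrix V V ℝ) - G.adjMatrix ℝ with hB
  have hBmul (z : V → ℝ) : B *ᵥ z = specRad G • z - G.adjMatrix ℝ *ᵥ z := by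
    simp [hB, Matrix.sub_mulVec, Matrix.smul_mulVec]
  have hH : B.IsHermitian := by
    ext i j
    simp [hB, Matrix.one_apply, SimpleGraph.adj_comm, eq_comm]
  have hpos : B.PosSemidef := by
    rw [hH.posSemidef_iff_eigenvalues_nonneg]
    intro i
    have h1 := hH.mulVec_eigenvectorBasis i
    rw [hBmul] at h1
    set z : V → ℝ := (hH.eigenvectorBasis i).ofLp with hz
    have hz0 : z ≠ 0 := by
      intro h0
      have := hH.eigenvectorBasis.orthonormal.ne_zero i
      apply this
      ext j
      exact congrFun h0 j
    have h2 : Module.End.HasEigenvalue (Matrix.mulVecLin (G.adjMatrix ℝ))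
        (specRad G - hH.eigenvalues i) := by
      apply Module.End.hasEigenvalue_of_hasEigenvector (x := z)
      rw [Module.End.hasEigenvector_iff]
      refine ⟨Module.End.mem_eigenspace_iff.2 ?_, hz0⟩
      rw [Matrix.mulVecLin_apply, sub_smul, ← h1]
      abel
    have := le_specRad h2
    simp only [Pi.zero_apply]
    linarith
  have := hpos.dotProduct_mulVec_nonneg y
  rw [hBmul] at this
  simp only [star_trivial, dotProduct_sub, dotProduct_smul, smul_eq_mul] at this
  linarith

/-- If the Rayleigh quotient of `x` is at least `r` and `(A x) u` exceeds `r * x u` at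
some vertex `u`, then the spectral radius exceeds `r`. -/
theorem lt_specRad {G : SimpleGraph V} {x : V → ℝ} {r : ℝ} {u : V}
    (h : r * (x ⬝ᵥ x) ≤ x ⬝ᵥ (G.adjMatrix ℝ *ᵥ x)) (hu : r * x u < (G.adjMatrix ℝ *ᵥ x) u) :
    r < specRad G := by
  by_contra! hr
  set δ := (G.adjMatrix ℝ *ᵥ x) u - r * x u with hδ
  have hδ0 : 0 < δ := by linarith
  set ε := δ / (|r| + 1) with hε
  have hε0 : 0 < ε := by positivity
  have hεδ : ε * (|r| + 1) = δ := by rw [hε]; field_simp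
  have key := dotProduct_adjMatrix_mulVec_le G (x + Pi.single u ε)
  have hyy : 0 ≤ (x + Pi.single u ε) ⬝ᵥ (x + Pi.single u ε) :=
    Finset.sum_nonneg fun i _ => mul_self_nonneg _
  have key2 := key.trans (mul_le_mul_of_nonneg_right hr hyy)
  have hsymm : x ⬝ᵥ (G.adjMatrix ℝ *ᵥ Pi.single u ε) = ε * (G.adjMatrix ℝ *ᵥ x) u := by
    rw [dotProduct_mulVec, ← mulVec_transpose, SimpleGraph.transpose_adjMatrix,
      dotProduct_single, mul_comm]
  have hzero : (G.adjMatrix ℝ *ᵥ Pi.single u ε) u = 0 := by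
    simp
  simp only [Matrix.mulVec_add, dotProduct_add, add_dotProduct, hsymm, single_dotProduct, hzero,
    dotProduct_single, Pi.add_apply, Pi.single_eq_same] at key2
  have : r ≤ |r| := le_abs_self r
  have h1 : 2 * (ε * δ) ≤ r * (ε * ε) := by rw [hδ]; linarith
  have h2 : r * (ε * ε) ≤ ε * δ := by rw [← hεδ]; nlinarith [mul_pos hε0 hε0]
  linarith [mul_pos hε0 hδ0]

theorem edgeCount_eq (G : SimpleGraph V) :
    (1 : V → ℝ) ⬝ᵥ (G.adjMatrix ℝ *ᵥ 1) = 2 * edgeCount G := by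
  have h := G.sum_degrees_eq_twice_card_edges
  have h2 : ((∑ v, G.degree v : ℕ) : ℝ) = 2 * edgeCount G := by
    rw [h, edgeCount]; push_cast; rfl
  rw [← h2]
  simp [dotProduct, SimpleGraph.adjMatrix_mulVec_apply]

theorem adjMatrix_mulVec_comp {G : SimpleGraph V} {H : SimpleGraph W} (e : G ≃g H) (y : W → ℝ) :
    G.adjMatrix ℝ *ᵥ (y ∘ e) = (H.adjMatrix ℝ *ᵥ y) ∘ e := by
  ext i
  simp only [Matrix.mulVec, dotProduct, Function.comp_apply, SimpleGraph.adjMatrix_apply]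
  rw [← e.toEquiv.sum_comp]
  refine Finset.sum_congr rfl fun j _ => ?_
  simp [SimpleGraph.Iso.map_adj_iff]

theorem hasEigenvalue_of_iso {G : SimpleGraph V} {H : SimpleGraph W} (e : G ≃g H) {μ : ℝ}
    (hμ : Module.End.HasEigenvalue (Matrix.mulVecLin (H.adjMatrix ℝ)) μ) :
    Module.End.HasEigenvalue (Matrix.mulVecLin (G.adjMatrix ℝ)) μ := by
  obtain ⟨y, hy⟩ := hμ.exists_hasEigenvector
  rw [Module.End.hasEigenvector_iff, Module.End.mem_eigenspace_iff] at hy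
  apply Module.End.hasEigenvalue_of_hasEigenvector (x := y ∘ e)
  rw [Module.End.hasEigenvector_iff, Module.End.mem_eigenspace_iff]
  refine ⟨?_, ?_⟩
  · rw [Matrix.mulVecLin_apply, adjMatrix_mulVec_comp, ← Matrix.mulVecLin_apply, hy.1]
    rfl
  · intro h0
    apply hy.2
    ext i
    simpa using congrFun h0 (e.symm i)

theorem specRad_eq_of_iso {G : SimpleGraph V} {H : SimpleGraph W} (e : G ≃g H) :
    specRad G = specRad H := by
  unfold specRad
  congr 1
  ext μ
  exact ⟨hasEigenvalue_of_iso e.symm, hasEigenvalue_of_iso e⟩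

theorem InFamily.of_iso {m : ℕ} {G : SimpleGraph V} {H : SimpleGraph W} (e : G ≃g H)
    (h : InFamily m G) : InFamily m H := by
  obtain ⟨h1, h2, h3, h4⟩ := h
  refine ⟨?_, ?_, ?_, ?_⟩
  · rintro ⟨f, hf⟩
    exact h1 ⟨f.trans e.symm.toEquiv.toEmbedding, fun a b hab =>
      e.symm.map_adj_iff.2 (hf a b hab)⟩
  · rw [← h2]
    have hG := edgeCount_eq G
    have hH := edgeCount_eq H
    have h1 : (1 : V → ℝ) = (1 : W → ℝ) ∘ e := rfl
    have : (1 : V → ℝ) ⬝ᵥ (G.adjMatrix ℝ *ᵥ 1) = (1 : W → ℝ) ⬝ᵥ (H.adjMatrix ℝ *ᵥ 1) := by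
      rw [h1, adjMatrix_mulVec_comp, dotProduct, dotProduct, ← e.toEquiv.sum_comp]
      rfl
    rw [hG, hH] at this
    exact_mod_cast (mul_left_cancel₀ two_ne_zero this).symm
  · intro v
    obtain ⟨w, hw⟩ := h3 (e.symm v)
    exact ⟨e w, by simpa using e.map_adj_iff.2 hw⟩
  · rintro ⟨g⟩
    exact h4 ⟨e.trans g⟩

theorem MaxInFamily.specRad_le {m : ℕ} {G : SimpleGraph V} {H : SimpleGraph W}
    (hG : MaxInFamily m G) (hH : InFamily m H) : specRad H ≤ specRad G := by
  let e : H ≃g H.map (Fintype.equivFin W).toEmbedding := SimpleGraph.Iso.map (Fintype.equivFin W) H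
  rw [specRad_eq_of_iso e]
  exact hG.2 _ _ (hH.of_iso e)

end Spectral

section Star

theorem starG_adj_zero {r : ℕ} {a b : Fin (r + 1)} (h : (starG r).Adj a b) : a = 0 ∨ b = 0 := by
  simpa [starG] using h.2

theorem starG_adj_iff {r : ℕ} {a b : Fin (r + 1)} :
    (starG r).Adj a b ↔ a ≠ b ∧ (a = 0 ∨ b = 0) := by
  simp [starG]

theorem starG_mulVec_zero (r : ℕ) (y : Fin (r + 1) → ℝ) :
    ((starG r).adjMatrix ℝ *ᵥ y) 0 = ∑ i : Fin r, y i.succ := by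
  simp only [Matrix.mulVec, dotProduct, SimpleGraph.adjMatrix_apply, starG_adj_iff]
  rw [Fin.sum_univ_succ]
  simp [(Fin.succ_ne_zero _).symm]

theorem starG_mulVec_succ (r : ℕ) (y : Fin (r + 1) → ℝ) (i : Fin r) :
    ((starG r).adjMatrix ℝ *ᵥ y) i.succ = y 0 := by
  simp only [Matrix.mulVec, dotProduct, SimpleGraph.adjMatrix_apply, starG_adj_iff]
  rw [Fin.sum_univ_succ]
  simp [Fin.succ_ne_zero]

theorem starG_inFamily {m : ℕ} (hm : 7 ≤ m) : InFamily m (starG m) := by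
  refine ⟨?_, ?_, ?_, ?_⟩
  · rintro ⟨f, hf⟩
    have h1 := starG_adj_zero (hf 0 1 (by simp [gem]))
    have h2 := starG_adj_zero (hf 2 3 (by simp [gem]))
    rcases h1 with h1 | h1 <;> rcases h2 with h2 | h2 <;>
      · have := f.injective (h1.trans h2.symm)
        revert this
        decide
  · have h := edgeCount_eq (starG m)
    rw [dotProduct, Fin.sum_univ_succ] at h
    simp only [starG_mulVec_zero, starG_mulVec_succ] at h
    simp at h
    exact_mod_cast (by linarith : (edgeCount (starG m) : ℝ) = m)
  · intro v
    by_cases hv : v = 0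
    · exact ⟨Fin.last m, starG_adj_iff.2 ⟨by
        rw [hv]; intro h
        have := congrArg Fin.val h
        simp at this
        omega, Or.inl hv⟩⟩
    · exact ⟨0, starG_adj_iff.2 ⟨hv, Or.inr rfl⟩⟩
  · rintro ⟨e⟩
    have hk : 2 ≤ (m - 1) / 2 := by omega
    have h1 := starG_adj_zero (e.symm.map_adj_iff.2
      (show (bookS ((m - 1) / 2)).Adj (Sum.inl 0) (Sum.inr ⟨0, by omega⟩) by simp [bookS]))
    have h2 := starG_adj_zero (e.symm.map_adj_iff.2
      (show (bookS ((m - 1) / 2)).Adj (Sum.inl 1) (Sum.inr ⟨1, by omega⟩) by simp [bookS]))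
    rcases h1 with h1 | h1 <;> rcases h2 with h2 | h2 <;>
      · have := e.symm.injective (h1.trans h2.symm)
        simp at this

theorem one_lt_specRad_starG {m : ℕ} (hm : 2 ≤ m) : 1 < specRad (starG m) := by
  apply lt_specRad (x := 1) (u := 0)
  · rw [edgeCount_eq, ← edgeCount_eq, dotProduct, dotProduct, Fin.sum_univ_succ,
      Fin.sum_univ_succ]
    simp only [starG_mulVec_zero, starG_mulVec_succ]
    have : (2 : ℝ) ≤ m := by exact_mod_cast hm
    simp
    linarith
  · rw [starG_mulVec_zero]
    have : (2 : ℝ) ≤ m := by exact_mod_cast hm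
    simp
    omega

end Star

section Transplant

variable {V : Type*} {G : SimpleGraph V} {C : Set V} {u v : V}

/-- The graph obtained from `G` by replacing each edge joining `v` to a vertex `a ∈ C`
by the edge joining `u` to `a`, when all edges leaving `C` end in `v`. -/
def transplant (G : SimpleGraph V) (C : Set V) (u v : V) (hu : u ∉ C) : SimpleGraph V where
  Adj a b := ((a ∈ C ↔ b ∈ C) ∧ G.Adj a b) ∨ (a ∈ C ∧ b = u ∧ G.Adj a v) ∨
    (b ∈ C ∧ a = u ∧ G.Adj b v)
  symm := ⟨by
    rintro a b (⟨h, h'⟩ | h | h)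
    · exact Or.inl ⟨h.symm, h'.symm⟩
    · exact Or.inr (Or.inr h)
    · exact Or.inr (Or.inl h)⟩
  loopless := ⟨by
    rintro a (⟨-, h⟩ | ⟨h, rfl, -⟩ | ⟨h, rfl, -⟩)
    · exact G.loopless.irrefl a h
    · exact hu h
    · exact hu h⟩

theorem transplant_eq_of_mem_of_notMem {hu : u ∉ C} {a b : V}
    (h : (transplant G C u v hu).Adj a b) (ha : a ∈ C) (hb : b ∉ C) : b = u := by
  rcases h with ⟨h, -⟩ | h | h
  · exact absurd (h.1 ha) hb
  · exact h.2.1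
  · exact absurd h.1 hb

theorem transplant_gemFree (hu : u ∉ C) (hv : v ∉ C) (hG : ¬ ContainsCopy gem G) :
    ¬ ContainsCopy gem (transplant G C u v hu) := by
  rintro ⟨f, hf⟩
  have out (h : ∀ i, f i ∉ C) : False := by
    refine hG ⟨f, fun a b hab => ?_⟩
    rcases hf a b hab with h' | h' | h'
    · exact h'.2
    · exact absurd h'.1 (h a)
    · exact absurd h'.1 (h b)
  have inn (h : ∀ i, f i ∉ C → f i = u) : False := by
    refine hG ⟨⟨fun i => if f i ∈ C then f i else v, ?_⟩, fun a b hab => ?_⟩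
    · intro i j hij
      by_cases hi : f i ∈ C <;> by_cases hj : f j ∈ C <;>
        simp only [hi, hj, if_true, if_false] at hij
      · exact f.injective hij
      · exact absurd (hij ▸ hi) hv
      · exact absurd (hij ▸ hj) hv
      · exact f.injective ((h i hi).trans (h j hj).symm)
    · change G.Adj (if f a ∈ C then f a else v) (if f b ∈ C then f b else v)
      have hne : f a ≠ f b := fun e => hab.ne (f.injective e)
      by_cases hi : f a ∈ C <;> by_cases hj : f b ∈ C <;>
        simp only [hi, hj, if_true, if_false]
      · rcases hf a b hab with h' | h' | h'
        · exact h'.2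
        · exact absurd (h'.2.1 ▸ hj) hu
        · exact absurd (h'.2.1 ▸ hi) hu
      · rcases hf a b hab with h' | h' | h'
        · exact absurd (h'.1.1 hi) hj
        · exact h'.2.2
        · exact absurd h'.1 hj
      · rcases hf a b hab with h' | h' | h'
        · exact absurd (h'.1.2 hj) hi
        · exact absurd h'.1 hi
        · exact h'.2.2.symm
      · exact absurd ((h a hi).trans (h b hj).symm) hne
  have hub (i : Fin 5) (hi : i ≠ 4) : gem.Adj 4 i := by
    simp [gem, hi.symm]
  have cross (i j : Fin 5) (hij : gem.Adj i j) (hi : f i ∈ C) (hj : f j ∉ C) : f j = u :=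
    transplant_eq_of_mem_of_notMem (hf i j hij) hi hj
  by_cases h4 : f 4 ∈ C
  · refine inn fun i hi => cross 4 i (hub i ?_) h4 hi
    rintro rfl
    exact hi h4
  by_cases h4u : f 4 = u
  · have hne (i : Fin 5) (hi : i ≠ 4) : f i ≠ u := fun e => hi (f.injective (e.trans h4u.symm))
    have step (i j : Fin 5) (hij : gem.Adj i j) (hi : i ≠ 4) (hj : j ≠ 4) :
        f i ∈ C ↔ f j ∈ C := by
      constructor
      · intro h
        by_contra h'
        exact hne j hj (cross i j hij h h')
      · intro h
        by_contra h'
        exact hne i hi (cross j i hij.symm h h')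
    have s01 := step 0 1 (by simp [gem]) (by decide) (by decide)
    have s12 := step 1 2 (by simp [gem]) (by decide) (by decide)
    have s23 := step 2 3 (by simp [gem]) (by decide) (by decide)
    by_cases h0 : f 0 ∈ C
    · apply inn
      intro i hi
      fin_cases i <;> simp_all
    · apply out
      intro i hi
      fin_cases i <;> simp_all
  · apply out
    intro i hi
    have h : i ≠ 4 := by
      rintro rfl
      exact h4 hi
    exact h4u (cross i 4 (hub i h).symm hi h4)

theorem transplant_not_iso_bookS (hu : u ∉ C) (hv : v ∉ C) (hvu : v ≠ u) {w : V} (hw : w ∈ C)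
    (k : ℕ) : ¬ Nonempty (transplant G C u v hu ≃g bookS k) := by
  rintro ⟨e⟩
  obtain ⟨i, hi⟩ : ∃ i : Fin 2, e.symm (Sum.inl i) ≠ u := by
    by_contra! h
    have := e.symm.injective ((h 0).trans (h 1).symm)
    simp at this
  set z := e.symm (Sum.inl i) with hz
  have huniv (a : V) (ha : z ≠ a) : (transplant G C u v hu).Adj z a := by
    rw [← e.map_adj_iff]
    have hza : e z ≠ e a := fun h => ha (e.injective h)
    rw [hz] at hza ⊢
    simp only [RelIso.apply_symm_apply] at hza ⊢
    exact ⟨hza, Or.inl rfl⟩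
  by_cases hzC : z ∈ C
  · exact hvu (transplant_eq_of_mem_of_notMem (huniv v fun h => hv (h ▸ hzC)) hzC hv)
  · exact hi (transplant_eq_of_mem_of_notMem (huniv w fun h => hzC (h ▸ hw)).symm hw hzC)

theorem transplant_exists_adj (hu : u ∉ C)
    (hC : ∀ a b, a ∈ C → b ∉ C → G.Adj a b → b = v) (hG : ∀ a, ∃ b, G.Adj a b)
    (hv' : ∃ w, w ∉ C ∧ G.Adj v w) (hv : v ∉ C) (a : V) :
    ∃ b, (transplant G C u v hu).Adj a b := by
  by_cases hav : a = v
  · obtain ⟨w, hw, h⟩ := hv'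
    exact ⟨w, Or.inl ⟨by simp [hav, hv, hw], hav ▸ h⟩⟩
  obtain ⟨b, hb⟩ := hG a
  by_cases ha : a ∈ C <;> by_cases hb' : b ∈ C
  · exact ⟨b, Or.inl ⟨by simp [ha, hb'], hb⟩⟩
  · exact ⟨u, Or.inr (Or.inl ⟨ha, rfl, hC a b ha hb' hb ▸ hb⟩)⟩
  · exact absurd (hC b a hb' ha hb.symm) hav
  · exact ⟨b, Or.inl ⟨by simp [ha, hb'], hb⟩⟩

theorem transplant_adjMatrix (hu : u ∉ C) (hv : v ∉ C) (hvu : v ≠ u)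
    (hC : ∀ a b, a ∈ C → b ∉ C → G.Adj a b → b = v) :
    (transplant G C u v hu).adjMatrix ℝ = G.adjMatrix ℝ +
      vecMulVec (fun a => if a ∈ C ∧ G.Adj a v then 1 else 0) (Pi.single u 1 - Pi.single v 1) +
      vecMulVec (Pi.single u 1 - Pi.single v 1) (fun a => if a ∈ C ∧ G.Adj a v then 1 else 0) := by
  ext a b
  have key : (transplant G C u v hu).Adj a b ↔ ((a ∈ C ↔ b ∈ C) ∧ G.Adj a b) ∨
    (a ∈ C ∧ b = u ∧ G.Adj a v) ∨ (b ∈ C ∧ a = u ∧ G.Adj b v) := Iff.rfl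
  simp only [Matrix.add_apply, SimpleGraph.adjMatrix_apply, vecMulVec_apply, Pi.sub_apply,
    Pi.single_apply, key]
  by_cases ha : a ∈ C <;> by_cases hb : b ∈ C
  · have h1 : a ≠ u := fun h => hu (h ▸ ha)
    have h2 : a ≠ v := fun h => hv (h ▸ ha)
    have h3 : b ≠ u := fun h => hu (h ▸ hb)
    have h4 : b ≠ v := fun h => hv (h ▸ hb)
    simp [ha, hb, h1, h2, h3, h4]
  · have h1 : a ≠ u := fun h => hu (h ▸ ha)
    have h2 : a ≠ v := fun h => hv (h ▸ ha)
    by_cases hbv : b = v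
    · subst hbv
      by_cases h : G.Adj a b <;> simp [ha, hv, h1, h2, hvu, h]
    · have h5 : ¬ G.Adj a b := fun h => hbv (hC a b ha hb h)
      by_cases hbu : b = u <;> by_cases h : G.Adj a v <;> simp [ha, hb, h1, h2, hbv, h5, hbu, h, hu]
      all_goals simp_all
  · have h1 : b ≠ u := fun h => hu (h ▸ hb)
    have h2 : b ≠ v := fun h => hv (h ▸ hb)
    by_cases hav : a = v
    · subst hav
      by_cases h : G.Adj b a <;> simp [hb, hv, h1, h2, hvu, h, G.adj_comm a b]
    · have h5 : ¬ G.Adj a b := fun h => hav (hC b a hb ha h.symm)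
      by_cases hau : a = u <;> by_cases h : G.Adj b v <;> simp [ha, hb, h1, h2, hav, h5, hau, h, hu]
      all_goals simp_all
  · simp [ha, hb]

variable [Fintype V]

theorem transplant_mulVec (hu : u ∉ C) (hv : v ∉ C) (hvu : v ≠ u)
    (hC : ∀ a b, a ∈ C → b ∉ C → G.Adj a b → b = v) (f : V → ℝ) :
    (transplant G C u v hu).adjMatrix ℝ *ᵥ f = G.adjMatrix ℝ *ᵥ f +
      (f u - f v) • (fun a => if a ∈ C ∧ G.Adj a v then (1 : ℝ) else 0) +
      ((fun a => if a ∈ C ∧ G.Adj a v then (1 : ℝ) else 0) ⬝ᵥ f) •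
        (Pi.single u 1 - Pi.single v 1 : V → ℝ) := by
  rw [transplant_adjMatrix hu hv hvu hC, Matrix.add_mulVec, Matrix.add_mulVec,
    vecMulVec_mulVec, vecMulVec_mulVec]
  simp [sub_dotProduct, -MulOpposite.op_sub]

theorem dotProduct_transplant_mulVec (hu : u ∉ C) (hv : v ∉ C) (hvu : v ≠ u)
    (hC : ∀ a b, a ∈ C → b ∉ C → G.Adj a b → b = v) (f : V → ℝ) :
    f ⬝ᵥ ((transplant G C u v hu).adjMatrix ℝ *ᵥ f) = f ⬝ᵥ (G.adjMatrix ℝ *ᵥ f) +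
      2 * (f u - f v) * ((fun a => if a ∈ C ∧ G.Adj a v then (1 : ℝ) else 0) ⬝ᵥ f) := by
  rw [transplant_mulVec hu hv hvu hC, dotProduct_add, dotProduct_add, dotProduct_smul,
    dotProduct_smul, dotProduct_sub, dotProduct_single, dotProduct_single, dotProduct_comm f]
  rw [dotProduct_comm f]
  simp only [smul_eq_mul]
  ring

theorem edgeCount_transplant (hu : u ∉ C) (hv : v ∉ C) (hvu : v ≠ u)
    (hC : ∀ a b, a ∈ C → b ∉ C → G.Adj a b → b = v) :
    edgeCount (transplant G C u v hu) = edgeCount G := by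
  have h := dotProduct_transplant_mulVec hu hv hvu hC 1
  rw [edgeCount_eq, edgeCount_eq] at h
  simp only [Pi.one_apply, sub_self, mul_zero, zero_mul, add_zero] at h
  exact_mod_cast mul_left_cancel₀ two_ne_zero h

theorem specRad_lt_specRad_transplant (hu : u ∉ C) (hv : v ∉ C) (hvu : v ≠ u)
    (hC : ∀ a b, a ∈ C → b ∉ C → G.Adj a b → b = v) {w : V} (hw : w ∈ C) (hwv : G.Adj w v)
    {x : V → ℝ} (hx : ∀ a, 0 < x a) (heig : G.adjMatrix ℝ *ᵥ x = specRad G • x)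
    (hvx : x v ≤ x u) : specRad G < specRad (transplant G C u v hu) := by
  have hpos : 0 < (fun a => if a ∈ C ∧ G.Adj a v then (1 : ℝ) else 0) ⬝ᵥ x := by
    refine Finset.sum_pos' (fun a _ => ?_) ⟨w, Finset.mem_univ _, ?_⟩
    · exact mul_nonneg (by dsimp only; split_ifs <;> norm_num) (hx a).le
    · simp [hw, hwv, hx w]
  apply lt_specRad (x := x) (u := u)
  · rw [dotProduct_transplant_mulVec hu hv hvu hC, heig, dotProduct_smul, smul_eq_mul]
    have := mul_nonneg (sub_nonneg.2 hvx) hpos.le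
    linarith
  · rw [transplant_mulVec hu hv hvu hC, heig]
    simp only [Pi.add_apply, Pi.smul_apply, Pi.sub_apply, smul_eq_mul, hu, false_and, if_false,
      Pi.single_eq_same, Pi.single_eq_of_ne hvu.symm]
    linarith

end Transplant

/-- A cut vertex `v` together with another vertex `u` gives a union of branches at `v`
avoiding `u`. -/
theorem IsCutVertex.exists_branch {V : Type*} {G : SimpleGraph V} {v : V} (u : V)
    (h : IsCutVertex G v) : ∃ C : Set V, u ∉ C ∧ v ∉ C ∧
      (∀ a b, a ∈ C → b ∉ C → G.Adj a b → b = v) ∧ (∃ w ∈ C, G.Adj w v) ∧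
      ∃ w, w ∉ C ∧ G.Adj v w := by
  let D (a : {x : V // x ≠ v}) : Set V :=
    {b | ∃ hb : b ≠ v, (G.induce {x : V | x ≠ v}).Reachable a ⟨b, hb⟩}
  have hvD (a) : v ∉ D a := fun ⟨hb, _⟩ => hb rfl
  have hD (a) : ∀ b c, b ∈ D a → c ∉ D a → G.Adj b c → c = v := by
    rintro b c ⟨hb, hr⟩ hc hbc
    by_contra hcv
    refine hc ⟨hcv, hr.trans (SimpleGraph.Adj.reachable ?_)⟩
    exact hbc
  have hself (a) : a.1 ∈ D a := ⟨a.2, SimpleGraph.Reachable.refl _⟩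
  have hex (a b : {x : V // x ≠ v}) (hab : G.Reachable a.1 b.1)
      (hn : ¬ (G.induce {x : V | x ≠ v}).Reachable a b) : ∃ w ∈ D a, G.Adj w v := by
    by_contra! hno
    obtain ⟨p⟩ := hab
    have : ∀ {c d : V} (p : G.Walk c d), c ∈ D a → d ∈ D a := by
      intro c d p
      induction p with
      | nil => exact id
      | cons hadj _ ih =>
        intro hc
        apply ih
        by_contra hd
        exact hno _ hc (hD a _ _ hc hd hadj ▸ hadj)
    obtain ⟨_, h'⟩ := this p (hself a)
    exact hn h'
  obtain ⟨a, b, hab, hn⟩ := h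
  have main (a b : {x : V // x ≠ v}) (hab : G.Reachable a.1 b.1)
      (hn : ¬ (G.induce {x : V | x ≠ v}).Reachable a b) (hu : u ∉ D a) :
      ∃ C : Set V, u ∉ C ∧ v ∉ C ∧
      (∀ a b, a ∈ C → b ∉ C → G.Adj a b → b = v) ∧ (∃ w ∈ C, G.Adj w v) ∧
      ∃ w, w ∉ C ∧ G.Adj v w := by
    refine ⟨D a, hu, hvD a, hD a, hex a b hab hn, ?_⟩
    obtain ⟨w, ⟨hw, hbw⟩, hwv⟩ := hex b a hab.symm fun h => hn h.symm
    exact ⟨w, fun ⟨_, haw⟩ => hn (haw.trans hbw.symm), hwv.symm⟩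
  by_cases hu : u ∈ D a
  · refine main b a hab.symm (fun h => hn h.symm) ?_
    rintro ⟨hb, hbu⟩
    obtain ⟨_, hau⟩ := hu
    exact hn (hau.trans hbu.symm)
  · exact main a b hab hn hu

theorem isCutVertex_of_pendant {V : Type*} {G : SimpleGraph V} {v w b : V} (hvw : G.Adj v w)
    (hv : ∀ z, G.Adj v z → z = w) (hwb : G.Adj w b) (hb : b ≠ v) : IsCutVertex G w := by
  refine ⟨⟨v, hvw.ne⟩, ⟨b, hwb.ne.symm⟩, hvw.reachable.trans hwb.reachable, ?_⟩
  rintro ⟨p⟩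
  cases p with
  | nil => exact hb rfl
  | @cons _ z _ h _ => exact z.2 (hv z.1 h)

theorem stmt6 {V : Type*} [Fintype V] (G : SimpleGraph V) (m : ℕ) (hm : 7 ≤ m)
    (hmax : MaxInFamily m G) (x : V → ℝ) (hx : ∀ v, 0 < x v)
    (heig : G.adjMatrix ℝ *ᵥ x = specRad G • x)
    (u : V) (hu : ∀ v, x v ≤ x u) :
    (∀ v, v ≠ u → ¬ IsCutVertex G v) ∧
      (∀ v, v ∉ insert u (G.neighborFinset u) → 2 ≤ G.degree v) := by
  obtain ⟨hgem, hedge, hiso, -⟩ := hmax.1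
  have hcut : ∀ v, v ≠ u → ¬ IsCutVertex G v := by
    intro v hvu hv
    obtain ⟨C, huC, hvC, hC, ⟨w, hw, hwv⟩, hout⟩ := hv.exists_branch u
    refine absurd (hmax.specRad_le (H := transplant G C u v huC) ⟨?_, ?_, ?_, ?_⟩)
      (specRad_lt_specRad_transplant huC hvC hvu hC hw hwv hx heig (hu v)).not_ge
    · exact transplant_gemFree huC hvC hgem
    · rw [edgeCount_transplant huC hvC hvu hC, hedge]
    · exact transplant_exists_adj huC hC hiso hout hvC
    · exact transplant_not_iso_bookS huC hvC hvu hw _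
  refine ⟨hcut, fun v hv => ?_⟩
  simp only [Finset.mem_insert, SimpleGraph.mem_neighborFinset, not_or] at hv
  by_contra! hdeg
  obtain ⟨w, hvw⟩ := hiso v
  have hwu : w ≠ u := by
    rintro rfl
    exact hv.2 hvw.symm
  have hvN : ∀ z, G.Adj v z → z = w := by
    intro z hz
    have : (G.neighborFinset v).card ≤ 1 := by
      rw [SimpleGraph.card_neighborFinset_eq_degree]; omega
    exact Finset.card_le_one.1 this z (by simpa using hz) w (by simpa using hvw)
  have hwN : ∀ z, G.Adj w z → z = v := by
    intro z hz
    by_contra hzv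
    exact hcut w hwu (isCutVertex_of_pendant hvw hvN hz hzv)
  have eig (a b : V) (hab : G.Adj a b) (ha : ∀ z, G.Adj a z → z = b) :
      x b = specRad G * x a := by
    have h := congrFun heig a
    rw [SimpleGraph.adjMatrix_mulVec_apply, Finset.sum_eq_single_of_mem b (by simpa using hab)
      (fun z hz hzb => absurd (ha z (by simpa using hz)) hzb)] at h
    simpa using h
  have h1 := eig v w hvw hvN
  have h2 := eig w v hvw.symm hwN
  have h3 : 1 < specRad G :=
    (one_lt_specRad_starG (by omega)).trans_le (hmax.specRad_le (starG_inFamily hm))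
  nlinarith [hx v, hx w]
end

section
/- Let Ĝ be the spectral-extremal gem-free graph as above with extremal vertex û, and suppose u_1, u_2, u_3 ∈ N_+(û) induce a triangle with x_{u_1} ≤ x_{u_2} ≤ x_{u_3}. If some u_i has a neighbor w in W = V(Ĝ) \ N[û], then N(w) ∩ {u_1,u_2,u_3} = {u_3}, and x_{u_i} < (20/41) x_{û} for i ∈ {1,2}. -/
open scoped Classical
open SimpleGraph Matrix

lemma exists_gem_iff {V : Type*} (G : SimpleGraph V) :
    ContainsCopy gem G ↔ ∃ o p₀ p₁ p₂ p₃ : V, G.Adj o p₀ ∧ G.Adj o p₁ ∧ G.Adj o p₂ ∧ G.Adj o p₃ ∧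
      G.Adj p₀ p₁ ∧ G.Adj p₁ p₂ ∧ G.Adj p₂ p₃ ∧ p₀ ≠ p₂ ∧ p₀ ≠ p₃ ∧ p₁ ≠ p₃ := by
  constructor
  · rintro ⟨f, hf⟩
    refine ⟨f 4, f 0, f 1, f 2, f 3, ?_, ?_, ?_, ?_, ?_, ?_, ?_, ?_, ?_, ?_⟩
    iterate 7 exact hf _ _ (by simp [gem])
    all_goals exact f.injective.ne (by decide)
  · rintro ⟨o, p₀, p₁, p₂, p₃, h0, h1, h2, h3, h01, h12, h23, n02, n03, n13⟩
    refine ⟨⟨![p₀, p₁, p₂, p₃, o], ?_⟩, ?_⟩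
    · have := h0.ne; have := h1.ne; have := h2.ne; have := h3.ne
      have := h01.ne; have := h12.ne; have := h23.ne
      intro i j
      fin_cases i <;> fin_cases j <;> simp <;> grind
    · intro i j
      change _ → G.Adj (![p₀, p₁, p₂, p₃, o] i) (![p₀, p₁, p₂, p₃, o] j)
      fin_cases i <;> fin_cases j <;> simp [gem] <;> simp [*, SimpleGraph.adj_comm]

lemma lt_specRad_s11 {V : Type*} [Fintype V] (H : SimpleGraph V) (y : V → ℝ) (t : ℝ)
    (h : t * (y ⬝ᵥ y) < y ⬝ᵥ (H.adjMatrix ℝ *ᵥ y)) : t < specRad H := by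
  by_contra! hle
  have hB : (t • (1 : Matrix V V ℝ) - H.adjMatrix ℝ).IsHermitian := by
    ext i j
    simp [Matrix.one_apply, SimpleGraph.adj_comm, eq_comm]
  have hpsd : (t • (1 : Matrix V V ℝ) - H.adjMatrix ℝ).PosSemidef := by
    rw [hB.posSemidef_iff_eigenvalues_nonneg]
    intro i
    have hev := hB.mulVec_eigenvectorBasis i
    have hne : (hB.eigenvectorBasis i).ofLp ≠ 0 := by
      intro h0
      have := hB.eigenvectorBasis.orthonormal.ne_zero i
      exact this (by ext j; simpa using congrFun h0 j)
    have hA : Module.End.HasEigenvalue (Matrix.mulVecLin (H.adjMatrix ℝ))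
        (t - hB.eigenvalues i) := by
      refine Module.End.hasEigenvalue_of_hasEigenvector
        (x := (hB.eigenvectorBasis i).ofLp) ⟨?_, hne⟩
      rw [Module.End.mem_eigenspace_iff, Matrix.mulVecLin_apply, sub_smul, ← hev,
        Matrix.sub_mulVec, Matrix.smul_mulVec, Matrix.one_mulVec]
      abel
    have : t - hB.eigenvalues i ≤ specRad H :=
      le_csSup (Module.End.finite_hasEigenvalue _).bddAbove hA
    simp only [Pi.zero_apply]
    linarith
  have := hpsd.dotProduct_mulVec_nonneg y
  simp [Matrix.sub_mulVec, Matrix.smul_mulVec, dotProduct_sub] at this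
  linarith

lemma lt_specRad_of_inFamily {V V' : Type*} [Fintype V] [Fintype V'] {G : SimpleGraph V}
    {H : SimpleGraph V'} {m : ℕ} (hmax : MaxInFamily m G) (hH : InFamily m H) (y : V' → ℝ) (t : ℝ)
    (h : t * (y ⬝ᵥ y) < y ⬝ᵥ (H.adjMatrix ℝ *ᵥ y)) : t < specRad G := by
  let e := Fintype.equivFin V'
  let H' : SimpleGraph (Fin (Fintype.card V')) := H.comap e.symm
  let i : H' ≃g H := ⟨e.symm, by simp [H']⟩
  have hH' : InFamily m H' := by
    obtain ⟨h1, h2, h3, h4⟩ := hH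
    refine ⟨?_, ?_, ?_, ?_⟩
    · rintro ⟨f, hf⟩
      exact h1 ⟨f.trans e.symm.toEmbedding, fun a b hab => hf a b hab⟩
    · rw [← h2]
      exact i.card_edgeFinset_eq
    · intro v
      obtain ⟨w, hw⟩ := h3 (e.symm v)
      exact ⟨e w, by simpa [H'] using hw⟩
    · rintro ⟨j⟩
      exact h4 ⟨i.symm.trans j⟩
  refine (lt_specRad_s11 H' (y ∘ e.symm) t ?_).trans_le (hmax.2 _ _ hH')
  have e1 : (y ∘ e.symm) ⬝ᵥ (y ∘ e.symm) = y ⬝ᵥ y :=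
    Equiv.sum_comp e.symm (fun v => y v * y v)
  have e2 : (y ∘ e.symm) ⬝ᵥ (H'.adjMatrix ℝ *ᵥ (y ∘ e.symm)) = y ⬝ᵥ (H.adjMatrix ℝ *ᵥ y) := by
    rw [dotProduct, dotProduct, ← Equiv.sum_comp e.symm]
    refine Finset.sum_congr rfl fun v _ => ?_
    congr 1
    rw [mulVec, mulVec, dotProduct, dotProduct, ← Equiv.sum_comp e.symm]
    rfl
  rw [e1]
  exact e2 ▸ h

lemma two_mul_edgeCount {V : Type*} [Fintype V] (G : SimpleGraph V) :
    ∑ p, ∑ q, (if G.Adj p q then (1 : ℝ) else 0) = 2 * edgeCount G := by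
  have := G.sum_degrees_eq_twice_card_edges
  rw [edgeCount]
  have h2 : ((∑ v, G.degree v : ℕ) : ℝ) = 2 * (G.edgeFinset.card : ℝ) := by
    rw [this]; push_cast; rfl
  rw [← h2]
  push_cast
  refine Finset.sum_congr rfl fun v _ => ?_
  rw [← G.card_neighborFinset_eq_degree, neighborFinset_eq_filter]
  simp

lemma pendantS_sum (s t : ℕ) (i : Fin 2 ⊕ (Fin s ⊕ Fin t)) (y : Fin 2 ⊕ (Fin s ⊕ Fin t) → ℝ) :
    ∑ j, (if (pendantS s t).Adj i j then y j else 0) =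
      Sum.elim (fun k => ∑ j, (if k = j then 0 else y (.inl j)) + (∑ j, y (.inr (.inl j)) +
          if k = 0 then ∑ j, y (.inr (.inr j)) else 0))
        (Sum.elim (fun _ => ∑ j, y (.inl j)) (fun _ => y (.inl 0))) i := by
  rw [Fintype.sum_sum_type, Fintype.sum_sum_type]
  have h01 : ∀ k : Fin 2, k = 0 ∨ k = 1 := by decide
  rcases i with k | k | k
  · rcases h01 k with rfl | rfl <;> simp [pendantS]
  · simp [pendantS]
  · simp [pendantS]

lemma inFamily_pendantS (s : ℕ) : InFamily (2 * s + 3) (pendantS s 2) := by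
  refine ⟨?_, ?_, ?_, ?_⟩
  · rw [exists_gem_iff]
    have key : ∀ p q, (pendantS s 2).Adj p q → (p = Sum.inl 0 ∨ p = Sum.inl 1) ∨
        (q = Sum.inl 0 ∨ q = Sum.inl 1) := by
      have h2 : ∀ i : Fin 2, i = 0 ∨ i = 1 := by decide
      rintro (i | i | i) (j | j | j) <;> simp [pendantS, h2]
    rintro ⟨o, p₀, p₁, p₂, p₃, h0, h1, h2, h3, h01, h12, h23, n02, n03, n13⟩
    have := key _ _ h0; have := key _ _ h1; have := key _ _ h2; have := key _ _ h3
    have := key _ _ h01; have := key _ _ h12; have := key _ _ h23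
    have := h0.ne; have := h1.ne; have := h2.ne; have := h3.ne
    have := h01.ne; have := h12.ne; have := h23.ne
    grind
  · have h := two_mul_edgeCount (pendantS s 2)
    have : (edgeCount (pendantS s 2) : ℝ) = (2 * s + 3 : ℕ) := by
      simp only [pendantS_sum s 2 _ (fun _ => 1)] at h
      simp [Fin.sum_univ_two] at h
      push_cast
      linarith
    exact_mod_cast this
  · rintro (i | i | i)
    · exact ⟨.inl (1 - i), by fin_cases i <;> simp [pendantS]⟩
    · exact ⟨.inl 0, by simp [pendantS]⟩
    · exact ⟨.inl 0, by simp [pendantS]⟩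
  · rintro ⟨i⟩
    have := Fintype.card_congr i.toEquiv
    simp at this

lemma specRad_bound_of_max {V : Type*} [Fintype V] {G : SimpleGraph V} {m : ℕ} (hodd : Odd m)
    (hm : 23 ≤ m) (hmax : MaxInFamily m G) :
    (5.1 : ℝ) < specRad G ∧ (m : ℝ) - 2 < specRad G ^ 2 - specRad G := by
  obtain ⟨k, rfl⟩ := hodd
  obtain ⟨s, rfl⟩ : ∃ s, k = s + 1 := ⟨k - 1, by omega⟩
  have hs : (10 : ℝ) ≤ s := by exact_mod_cast (by omega : 10 ≤ s)
  have e : 2 * (s + 1) + 1 = 2 * s + 3 := by ring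
  rw [e] at hmax ⊢
  set t : ℝ := (1 + √(8 * s + 5)) / 2 with ht
  have hsq : t ^ 2 - t = 2 * s + 1 := by
    have := Real.sq_sqrt (show (0 : ℝ) ≤ 8 * s + 5 by positivity)
    rw [ht]; nlinarith
  have ht5 : 5.1 < t := by
    have : (9.2 : ℝ) < √(8 * s + 5) := by
      apply Real.lt_sqrt_of_sq_lt; norm_num; linarith
    rw [ht]; linarith
  have htG : t < specRad G := by
    have hst : (s : ℝ) = (t ^ 2 - t - 1) / 2 := by linarith
    refine lt_specRad_of_inFamily hmax (inFamily_pendantS s)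
      (Sum.elim ![t ^ 2 + t + 1, t ^ 2 + t - 1]
        (Sum.elim (fun _ => (2 * (t ^ 2 + t)) / t) (fun _ => (t ^ 2 + t + 1) / t))) t ?_
    simp only [dotProduct, mulVec, adjMatrix_apply, ite_mul, one_mul, zero_mul, pendantS_sum]
    simp [Fin.sum_univ_two]
    rw [hst, ← sub_pos]
    have ht0 : t ≠ 0 := by linarith
    have : 0 < 2 * (t ^ 2 + t + 1) / t := by positivity
    convert this using 1
    field_simp
    ring
  refine ⟨ht5.trans htG, ?_⟩
  push_cast
  nlinarith

lemma not_adj_of_adj_clique {V : Type*} {G : SimpleGraph V} (hG : ¬ ContainsCopy gem G)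
    {p q r s y : V} (hpq : G.Adj p q) (hpr : G.Adj p r) (hps : G.Adj p s) (hqr : G.Adj q r)
    (hrs : G.Adj r s) (hqs : q ≠ s) (hyr : y ≠ r) (hys : y ≠ s) (hyp : G.Adj y p) : ¬ G.Adj y q :=
  fun hyq => hG ((exists_gem_iff G).2
    ⟨p, y, q, r, s, hyp.symm, hpq, hpr, hps, hyq, hqr, hrs, hyr, hys, hqs⟩)

lemma sum_split {V : Type*} [Fintype V] (G : SimpleGraph V) (u : V) (f : V → ℝ) :
    ∑ v, f v = f u + ∑ v ∈ G.neighborFinset u, f v + ∑ v ∈ Wset G u, f v := by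
  rw [← Finset.sum_insert (by simp), add_comm]
  exact (Finset.sum_sdiff (Finset.subset_univ _)).symm

lemma mem_Wset {V : Type*} [Fintype V] {G : SimpleGraph V} {u v : V} :
    v ∈ Wset G u ↔ v ≠ u ∧ ¬ G.Adj u v := by
  simp [Wset]

lemma inv_card_add_inv_card_ge_one {V : Type*} [Fintype V] {G : SimpleGraph V}
    (hG : ¬ ContainsCopy gem G) {u v w : V} (hv : G.Adj u v) (hw : G.Adj u w) (hvw : G.Adj v w) :
    1 ≤ (((G.neighborFinset u).filter (G.Adj v)).card : ℝ)⁻¹ +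
      (((G.neighborFinset u).filter (G.Adj w)).card : ℝ)⁻¹ := by
  set A := (G.neighborFinset u).filter (G.Adj v) with hA
  set B := (G.neighborFinset u).filter (G.Adj w) with hB
  have hwA : w ∈ A := by simp [hA, hw, hvw]
  have hvB : v ∈ B := by simp [hB, hv, hvw.symm]
  have hA1 : 1 ≤ A.card := Finset.card_pos.2 ⟨w, hwA⟩
  have hB1 : 1 ≤ B.card := Finset.card_pos.2 ⟨v, hvB⟩
  have key : ∀ a ∈ A, ∀ b ∈ B, a ≠ w → b ≠ v → a = b := by
    intro a ha b hb haw hbv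
    simp only [hA, hB, Finset.mem_filter, mem_neighborFinset] at ha hb
    by_contra hab
    exact hG ((exists_gem_iff G).2 ⟨u, a, v, w, b, ha.1, hv, hw, hb.1, ha.2.symm, hvw, hb.2,
      haw, hab, hbv.symm⟩)
  have hcases : A.card = 1 ∨ B.card = 1 ∨ (A.card ≤ 2 ∧ B.card ≤ 2) := by
    by_cases h1 : A.card = 1
    · exact .inl h1
    by_cases h2 : B.card = 1
    · exact .inr (.inl h2)
    obtain ⟨a, ha, haw⟩ := Finset.exists_mem_ne (by omega : 1 < A.card) w
    obtain ⟨b, hb, hbv⟩ := Finset.exists_mem_ne (by omega : 1 < B.card) v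
    refine .inr (.inr ⟨?_, ?_⟩)
    · refine (Finset.card_le_card (t := {w, b}) fun c hc => ?_).trans Finset.card_le_two
      by_cases hcw : c = w
      · simp [hcw]
      · simp [key c hc b hb hcw hbv]
    · refine (Finset.card_le_card (t := {v, a}) fun c hc => ?_).trans Finset.card_le_two
      by_cases hcv : c = v
      · simp [hcv]
      · simp [key a ha c hc haw hcv]
  have hA0 : (0 : ℝ) ≤ (A.card : ℝ)⁻¹ := by positivity
  have hB0 : (0 : ℝ) ≤ (B.card : ℝ)⁻¹ := by positivity
  rcases hcases with h | h | ⟨h, h'⟩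
  · simp [h]
  · simp [h]
  · have e1 : (2 : ℝ)⁻¹ ≤ (A.card : ℝ)⁻¹ := by
      apply inv_anti₀ <;> norm_cast
    have e2 : (2 : ℝ)⁻¹ ≤ (B.card : ℝ)⁻¹ := by
      apply inv_anti₀ <;> norm_cast
    linarith

lemma sum_card_sub_one_mul_le {V : Type*} [Fintype V] {G : SimpleGraph V}
    (hG : ¬ ContainsCopy gem G) {x : V → ℝ} (hx : ∀ v, 0 < x v) {u : V} (hu : ∀ v, x v ≤ x u) :
    ∑ v ∈ G.neighborFinset u, ((((G.neighborFinset u).filter (G.Adj v)).card : ℝ) - 1) * x v ≤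
      (∑ v ∈ G.neighborFinset u, (((G.neighborFinset u).filter (G.Adj v)).card : ℝ)) / 2 * x u := by
  set N := G.neighborFinset u with hN
  let d : V → ℝ := fun v => ((N.filter (G.Adj v)).card : ℝ)
  let a : V → V → ℝ := fun v w => if G.Adj v w then 1 else 0
  have had : ∀ v, ∑ w ∈ N, a v w = d v := fun v => by simp [a, d]
  have hterm : ∀ v, (d v - 1) * x v ≤ (d v - d v * (d v)⁻¹) * x u := by
    intro v
    have hv := hx v
    have huv := hu v
    by_cases h0 : (N.filter (G.Adj v)).card = 0
    · have : d v = 0 := by simp [d, h0]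
      rw [this]; simp; linarith
    · have h1 : (1 : ℝ) ≤ d v := by
        have : 1 ≤ (N.filter (G.Adj v)).card := by omega
        exact Nat.one_le_cast.2 this
      rw [mul_inv_cancel₀ (by linarith)]
      exact mul_le_mul_of_nonneg_left huv (by linarith)
  have hswap : ∑ v ∈ N, ∑ w ∈ N, a v w * (d w)⁻¹ = ∑ v ∈ N, ∑ w ∈ N, a v w * (d v)⁻¹ := by
    rw [Finset.sum_comm]
    simp [a, G.adj_comm]
  have hmul : ∑ v ∈ N, ∑ w ∈ N, a v w * (d v)⁻¹ = ∑ v ∈ N, d v * (d v)⁻¹ :=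
    Finset.sum_congr rfl fun v _ => by rw [← Finset.sum_mul, had]
  have hge : ∑ v ∈ N, ∑ w ∈ N, a v w ≤
      ∑ v ∈ N, ∑ w ∈ N, (a v w * (d v)⁻¹ + a v w * (d w)⁻¹) := by
    refine Finset.sum_le_sum fun v hv => Finset.sum_le_sum fun w hw => ?_
    by_cases h : G.Adj v w
    · simpa [a, h] using inv_card_add_inv_card_ge_one hG (by simpa [hN] using hv)
        (by simpa [hN] using hw) h
    · simp [a, h]
  simp only [Finset.sum_add_distrib] at hge
  rw [hswap, hmul, Finset.sum_congr rfl fun v _ => had v] at hge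
  calc ∑ v ∈ N, (d v - 1) * x v ≤ ∑ v ∈ N, (d v - d v * (d v)⁻¹) * x u :=
        Finset.sum_le_sum fun v _ => hterm v
    _ = (∑ v ∈ N, d v - ∑ v ∈ N, d v * (d v)⁻¹) * x u := by
        rw [← Finset.sum_mul, Finset.sum_sub_distrib]
    _ ≤ (∑ v ∈ N, d v) / 2 * x u :=
        mul_le_mul_of_nonneg_right (by linarith) (hx u).le

lemma specRad_sq_sub_le {V : Type*} [Fintype V] {G : SimpleGraph V} {m : ℕ}
    (hG : ¬ ContainsCopy gem G) (hcard : edgeCount G = m)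
    {x : V → ℝ} (hx : ∀ v, 0 < x v) {ρ : ℝ}
    (heig : ∀ v, ∑ w, (if G.Adj v w then x w else 0) = ρ * x v)
    {u : V} (hu : ∀ v, x v ≤ x u) :
    ρ ^ 2 - ρ ≤ m - (∑ p ∈ Wset G u, ∑ q ∈ Wset G u, if G.Adj p q then (1 : ℝ) else 0) / 2 := by
  set N := G.neighborFinset u with hN
  set W := Wset G u with hW
  let d : V → ℝ := fun v => ((N.filter (G.Adj v)).card : ℝ)
  let a : V → V → ℝ := fun v w => if G.Adj v w then 1 else 0
  have had : ∀ v, ∑ w ∈ N, a v w = d v := fun v => by simp [a, d]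
  have hsymm : ∀ v w, a v w = a w v := fun v w => by simp [a, G.adj_comm]
  have hau : a u u = 0 := by simp [a]
  have hauN : ∀ v ∈ N, a u v = 1 := fun v hv => by
    have : G.Adj u v := by simpa [hN] using hv
    simp [a, this]
  have hauW : ∀ v ∈ W, a u v = 0 := fun v hv => by simp [a, (mem_Wset.1 hv).2]
  have heig' : ∀ v, ρ * x v = a v u * x u + ∑ w ∈ N, a v w * x w + ∑ w ∈ W, a v w * x w := by
    intro v
    rw [← heig, ← sum_split G u (fun w => a v w * x w)]
    simp [a]
  have hρ : ρ * x u = ∑ v ∈ N, x v := by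
    have h1 : ∑ w ∈ N, a u w * x w = ∑ w ∈ N, x w :=
      Finset.sum_congr rfl fun w hw => by rw [hauN w hw, one_mul]
    have h2 : ∑ w ∈ W, a u w * x w = 0 :=
      Finset.sum_eq_zero fun w hw => by rw [hauW w hw, zero_mul]
    rw [heig', hau, h1, h2]
    simp
  have hρ2 : ρ * (ρ * x u) = N.card * x u + ∑ v ∈ N, d v * x v +
      ∑ v ∈ N, ∑ w ∈ W, a v w * x w := by
    rw [hρ, Finset.mul_sum, Finset.sum_congr rfl fun v _ => heig' v, Finset.sum_add_distrib,
      Finset.sum_add_distrib]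
    congr 2
    · rw [← Finset.sum_mul, Finset.sum_congr rfl fun v hv => (hsymm v u).trans (hauN v hv)]
      simp
    · rw [Finset.sum_comm]
      refine Finset.sum_congr rfl fun v _ => ?_
      rw [← Finset.sum_mul, ← had]
      simp only [hsymm]
  have hNW : ∑ v ∈ N, ∑ w ∈ W, a v w * x w ≤ (∑ v ∈ N, ∑ w ∈ W, a v w) * x u := by
    simp only [Finset.sum_mul]
    refine Finset.sum_le_sum fun v _ => Finset.sum_le_sum fun w _ => ?_
    exact mul_le_mul_of_nonneg_left (hu w) (by simp only [a]; split_ifs <;> norm_num)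
  have hD := sum_card_sub_one_mul_le hG hx hu
  have hcount : (2 * m : ℝ) = N.card + (N.card + ∑ v ∈ N, d v + ∑ v ∈ N, ∑ w ∈ W, a v w) +
      (∑ v ∈ N, ∑ w ∈ W, a v w + ∑ v ∈ W, ∑ w ∈ W, a v w) := by
    rw [← hcard, ← two_mul_edgeCount, sum_split G u]
    congr 2
    · rw [sum_split G u]
      change a u u + ∑ v ∈ N, a u v + ∑ v ∈ W, a u v = _
      rw [hau, Finset.sum_congr rfl hauN, Finset.sum_congr rfl hauW]
      simp
    · change ∑ v ∈ N, ∑ w, a v w = _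
      rw [Finset.sum_congr rfl fun v _ => sum_split G u (a v), Finset.sum_add_distrib,
        Finset.sum_add_distrib, Finset.sum_congr rfl fun v hv => (hsymm v u).trans (hauN v hv),
        Finset.sum_congr rfl fun v _ => had v]
      simp [hW]
    · change ∑ v ∈ W, ∑ w, a v w = _
      rw [Finset.sum_congr rfl fun v _ => sum_split G u (a v), Finset.sum_add_distrib,
        Finset.sum_add_distrib, Finset.sum_congr rfl fun v hv => (hsymm v u).trans (hauW v hv)]
      rw [Finset.sum_const_zero, zero_add]
      congr 1
      rw [Finset.sum_comm]
      simp only [hsymm, hN]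
  change _ ≤ m - (∑ p ∈ W, ∑ q ∈ W, a p q) / 2
  have hD' : ∑ v ∈ N, (d v - 1) * x v ≤ (∑ v ∈ N, d v) / 2 * x u := hD
  simp only [sub_mul, one_mul, Finset.sum_sub_distrib] at hD'
  refine le_of_mul_le_mul_right ?_ (hx u)
  have : (m : ℝ) * x u = (N.card + (∑ v ∈ N, d v) / 2 + ∑ v ∈ N, ∑ w ∈ W, a v w +
    (∑ v ∈ W, ∑ w ∈ W, a v w) / 2) * x u := by
    congr 1; linarith
  linarith

lemma Wset_edges_eq {V : Type*} [Fintype V] {G : SimpleGraph V} {u : V}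
    (hlt : (∑ p ∈ Wset G u, ∑ q ∈ Wset G u, if G.Adj p q then (1 : ℝ) else 0) < 4)
    {p q r s : V} (hp : p ∈ Wset G u) (hq : q ∈ Wset G u) (hr : r ∈ Wset G u) (hs : s ∈ Wset G u)
    (hpq : G.Adj p q) (hrs : G.Adj r s) : (r = p ∧ s = q) ∨ (r = q ∧ s = p) := by
  by_contra hne
  rw [← Finset.sum_product', Finset.sum_boole] at hlt
  have hlt' : ((Wset G u ×ˢ Wset G u).filter fun e => G.Adj e.1 e.2).card < 4 := by
    exact_mod_cast hlt
  have hsub : ({(p, q), (q, p), (r, s), (s, r)} : Finset (V × V)) ⊆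
      (Wset G u ×ˢ Wset G u).filter fun e => G.Adj e.1 e.2 := by
    intro e he
    simp only [Finset.mem_insert, Finset.mem_singleton] at he
    rcases he with rfl | rfl | rfl | rfl <;> simp [*, hpq.symm, hrs.symm]
  have hc : ({(p, q), (q, p), (r, s), (s, r)} : Finset (V × V)).card = 4 := by
    have := hpq.ne
    have := hrs.ne
    rw [Finset.card_insert_of_notMem, Finset.card_insert_of_notMem, Finset.card_insert_of_notMem,
      Finset.card_singleton] <;> simp <;> grind
  have := Finset.card_le_card hsub
  omega

lemma mulVec_adjMatrix_apply {V : Type*} [Fintype V] (G : SimpleGraph V) (y : V → ℝ) (v : V) :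
    (G.adjMatrix ℝ *ᵥ y) v = ∑ w, if G.Adj v w then y w else 0 := by
  simp [mulVec, dotProduct, adjMatrix_apply]

lemma sum_moved_edge {V : Type*} [Fintype V] {G H : SimpleGraph V} {w a c : V}
    (hH : H = G \ edge w a ⊔ edge w c) (hwa : G.Adj w a) (hwc : ¬ G.Adj w c) (hne : w ≠ c)
    (f : V → V → ℝ) :
    ∑ p, ∑ q, (if H.Adj p q then f p q else 0) =
      ∑ p, ∑ q, (if G.Adj p q then f p q else 0) - f w a - f a w + f w c + f c w := by
  have hac : a ≠ c := by rintro rfl; exact hwc hwa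
  have hpt : ∀ p q, (if H.Adj p q then f p q else 0) =
      (if G.Adj p q then f p q else 0) - (if p = w then if q = a then f p q else 0 else 0) -
        (if p = a then if q = w then f p q else 0 else 0) +
        (if p = w then if q = c then f p q else 0 else 0) +
        (if p = c then if q = w then f p q else 0 else 0) := by
    intro p q
    have h1 := hwa.symm
    have h2 : ¬ G.Adj c w := fun h => hwc h.symm
    have h3 := hwa.ne
    have hHpq : H.Adj p q ↔ (G.Adj p q ∧ ¬ ((p = w ∧ q = a ∨ p = a ∧ q = w) ∧ p ≠ q)) ∨
        (p = w ∧ q = c ∨ p = c ∧ q = w) ∧ p ≠ q := by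
      rw [hH, sup_adj, sdiff_adj, edge_adj, edge_adj]
    split_ifs <;> grind
  simp only [hpt, Finset.sum_add_distrib, Finset.sum_sub_distrib]
  simp

lemma gem_free_moved_edge {V : Type*} [Fintype V] {G : SimpleGraph V}
    (hG : ¬ ContainsCopy gem G) {u a b c w : V}
    (hW : ∀ p ∈ Wset G u, ∀ q ∈ Wset G u, ∀ r ∈ Wset G u, G.Adj p q → G.Adj p r → q = r)
    (hua : G.Adj u a) (hub : G.Adj u b) (huc : G.Adj u c) (hab : G.Adj a b) (hac : G.Adj a c)
    (hbc : G.Adj b c) (hw : w ∈ Wset G u) (hwa : G.Adj w a) :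
    ¬ ContainsCopy gem (G \ edge w a ⊔ edge w c) := by
  obtain ⟨hwu, huw⟩ := mem_Wset.1 hw
  have hwc : w ≠ c := by rintro rfl; exact huw huc
  have hwb : w ≠ b := by rintro rfl; exact huw hub
  have hab' : ∀ p q, p ≠ w → q ≠ w → (G \ edge w a ⊔ edge w c).Adj p q → G.Adj p q := by
    intro p q hp hq h
    simp only [sup_adj, sdiff_adj, edge_adj] at h
    grind
  have hold : ∀ p q, p ≠ c → q ≠ c → (G \ edge w a ⊔ edge w c).Adj p q → G.Adj p q := by
    intro p q hp hq h
    simp only [sup_adj, sdiff_adj, edge_adj] at h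
    grind
  have hwna : ¬ (G \ edge w a ⊔ edge w c).Adj w a := by
    simp only [sup_adj, sdiff_adj, edge_adj]
    have := hac.ne
    have := hwa.ne
    grind
  set G' := G \ edge w a ⊔ edge w c with hG'
  have hnb : ∀ y, G'.Adj w y → G'.Adj c y → y ∈ Wset G u ∧ G.Adj w y ∧ G.Adj c y := by
    intro y hwy hcy
    have hyw := hwy.ne'
    have h1 := hold w y hwc hcy.ne' hwy
    have h2 := hab' c y hwc.symm hyw hcy
    refine ⟨mem_Wset.2 ⟨?_, fun huy => ?_⟩, h1, h2⟩
    · rintro rfl; exact huw h1.symm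
    · have hya : y ≠ a := by rintro rfl; exact hwna hwy
      have hyb : y ≠ b := by
        rintro rfl
        exact not_adj_of_adj_clique hG hab hua.symm hac hub.symm huc hbc.ne hwu hwc hwa h1
      exact not_adj_of_adj_clique hG huc hua hub hac.symm hab hbc.ne' hya hyb huy.symm h2.symm
  have hcz : ∀ z y, G'.Adj w z → G'.Adj c z → G'.Adj c y → G'.Adj z y → y = w := by
    intro z y hwz hcz hcy hzy
    obtain ⟨hz, hwz', hcz'⟩ := hnb z hwz hcz
    by_contra hyw
    have h1 := hab' c y hwc.symm hyw hcy
    have h2 := hab' z y hwz.ne' hyw hzy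
    obtain ⟨hzu, huz⟩ := mem_Wset.1 hz
    by_cases huy : G.Adj u y
    · by_cases hya : y = a
      · subst hya
        exact not_adj_of_adj_clique hG hac hua.symm hab huc.symm hub hbc.ne' hzu
          (by rintro rfl; exact huz hub) h2 hcz'.symm
      by_cases hyb : y = b
      · subst hyb
        exact not_adj_of_adj_clique hG hbc hub.symm hab.symm huc.symm hua hac.ne' hzu
          (by rintro rfl; exact huz hua) h2 hcz'.symm
      exact not_adj_of_adj_clique hG huc hua hub hac.symm hab hbc.ne' hya hyb huy.symm h1.symm
    · have hyu : y ≠ u := by rintro rfl; exact huz h2.symm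
      exact hyw (hW z hz y (mem_Wset.2 ⟨hyu, huy⟩) w hw h2 hwz'.symm)
  have huniq : ∀ y z, G'.Adj w y → G'.Adj c y → G'.Adj w z → G'.Adj c z → y = z := by
    intro y z h1 h2 h3 h4
    obtain ⟨hy, hwy, -⟩ := hnb y h1 h2
    obtain ⟨hz, hwz, -⟩ := hnb z h3 h4
    exact hW w hw y hy z hz hwy hwz
  have hedge : ∀ p q, G'.Adj p q → ¬ G.Adj p q → (p = w ∧ q = c) ∨ (p = c ∧ q = w) := by
    intro p q h h'
    by_contra hne
    apply h'
    simp only [hG', sup_adj, sdiff_adj, edge_adj] at h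
    grind
  rw [exists_gem_iff]
  have hspoke : ∀ o p₀ p₁ p₂, G'.Adj o p₀ → G'.Adj o p₁ → G'.Adj o p₂ → G'.Adj p₀ p₁ →
      G'.Adj p₁ p₂ → p₀ ≠ p₂ → G.Adj o p₁ := by
    intro o p₀ p₁ p₂ h0 h1 h2 h01 h12 hne
    by_contra hn
    rcases hedge _ _ h1 hn with ⟨rfl, rfl⟩ | ⟨rfl, rfl⟩
    · exact hne (huniq _ _ h0 h01.symm h2 h12)
    · exact hne (huniq _ _ h01.symm h0 h12 h2)
  have hend : ∀ o p₀ p₁ p₂ p₃, G'.Adj o p₀ → G'.Adj o p₁ → G'.Adj o p₂ → G'.Adj o p₃ →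
      G'.Adj p₀ p₁ → G'.Adj p₁ p₂ → G'.Adj p₂ p₃ → p₀ ≠ p₂ → p₀ ≠ p₃ → p₁ ≠ p₃ →
      p₀ ≠ c ∨ (o ≠ w ∧ p₁ ≠ w) := by
    intro o p₀ p₁ p₂ p₃ h0 h1 h2 h3 h01 h12 h23 n02 n03 n13
    by_contra! hcon
    obtain ⟨rfl, how⟩ := hcon
    have hop : o ∈ Wset G u ∧ p₁ ∈ Wset G u ∧ G.Adj o p₁ := by
      by_cases ho : o = w
      · subst ho
        obtain ⟨h, h', -⟩ := hnb _ h1 h01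
        exact ⟨hw, h, h'⟩
      · obtain rfl := how ho
        obtain ⟨h, h', -⟩ := hnb _ h1.symm h0.symm
        exact ⟨h, hw, h'.symm⟩
    obtain ⟨ho, hp, hop⟩ := hop
    have g2 := hold _ _ h0.ne n02.symm h2
    have g12 := hold _ _ h01.ne' n02.symm h12
    have g3 := hold _ _ h0.ne n03.symm h3
    have g23 := hold _ _ n02.symm n03.symm h23
    have hnot : ∀ y, G.Adj o y → p₁ ≠ y → G.Adj u y := by
      intro y hy hne
      by_contra hu
      refine hne (hW o ho p₁ hp y (mem_Wset.2 ⟨?_, hu⟩) hop hy)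
      rintro rfl
      exact (mem_Wset.1 ho).2 hy.symm
    have hu2 := hnot _ g2 h12.ne
    have hu3 := hnot _ g3 n13
    exact hG ((exists_gem_iff G).2 ⟨p₂, p₁, o, p₃, u, g12.symm, g2.symm, g23, hu2.symm, hop.symm,
      g3, hu3.symm, n13, (mem_Wset.1 hp).1, (mem_Wset.1 ho).1⟩)
  have hends : ∀ o p₀ p₁ p₂ p₃, G'.Adj o p₀ → G'.Adj o p₁ → G'.Adj o p₂ → G'.Adj o p₃ →
      G'.Adj p₀ p₁ → G'.Adj p₁ p₂ → G'.Adj p₂ p₃ → p₀ ≠ p₂ → p₀ ≠ p₃ → p₁ ≠ p₃ →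
      G.Adj o p₀ ∧ G.Adj p₀ p₁ := by
    intro o p₀ p₁ p₂ p₃ h0 h1 h2 h3 h01 h12 h23 n02 n03 n13
    have := hend o p₀ p₁ p₂ p₃ h0 h1 h2 h3 h01 h12 h23 n02 n03 n13
    constructor
    · by_contra hn
      rcases hedge _ _ h0 hn with ⟨rfl, rfl⟩ | ⟨rfl, rfl⟩
      · simp at this
      · exact n02 (hcz p₁ p₂ h01 h1 h2 h12).symm
    · by_contra hn
      rcases hedge _ _ h01 hn with ⟨rfl, rfl⟩ | ⟨rfl, rfl⟩
      · exact n02 (hcz o p₂ h0.symm h1.symm h12 h2).symm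
      · simp at this
  rintro ⟨o, p₀, p₁, p₂, p₃, h0, h1, h2, h3, h01, h12, h23, n02, n03, n13⟩
  obtain ⟨g0, g01⟩ := hends o p₀ p₁ p₂ p₃ h0 h1 h2 h3 h01 h12 h23 n02 n03 n13
  obtain ⟨g3, g32⟩ := hends o p₃ p₂ p₁ p₀ h3 h2 h1 h0 h23.symm h12.symm h01.symm n13.symm n03.symm
    n02.symm
  have g12 : G.Adj p₁ p₂ := by
    by_contra hn
    rcases hedge _ _ h12 hn with ⟨rfl, rfl⟩ | ⟨rfl, rfl⟩
    · exact n13 (hcz o p₃ h1.symm h2.symm h23 h3).symm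
    · exact n02 (hcz o p₀ h2.symm h1.symm h01.symm h0)
  exact hG ((exists_gem_iff G).2 ⟨o, p₀, p₁, p₂, p₃, g0, hspoke o p₀ p₁ p₂ h0 h1 h2 h01 h12 n02,
    hspoke o p₁ p₂ p₃ h1 h2 h3 h12 h23 n13, g3, g01, g12, g32.symm, n02, n03, n13⟩)

lemma not_iso_bookS_of_clique {V : Type*} {G : SimpleGraph V} {u a b c : V} (k : ℕ)
    (hua : G.Adj u a) (hub : G.Adj u b) (huc : G.Adj u c) (hab : G.Adj a b) (hac : G.Adj a c)
    (hbc : G.Adj b c) : ¬ Nonempty (G ≃g bookS k) := by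
  rintro ⟨i⟩
  have key : ∀ p q, (bookS k).Adj p q → (p = Sum.inl 0 ∨ p = Sum.inl 1) ∨
      (q = Sum.inl 0 ∨ q = Sum.inl 1) := by
    have h2 : ∀ i : Fin 2, i = 0 ∨ i = 1 := by decide
    rintro (i | i) (j | j) <;> simp [bookS, h2]
  have e1 := i.map_adj_iff.2 hua
  have e2 := i.map_adj_iff.2 hub
  have e3 := i.map_adj_iff.2 huc
  have e4 := i.map_adj_iff.2 hab
  have e5 := i.map_adj_iff.2 hac
  have e6 := i.map_adj_iff.2 hbc
  have := key _ _ e1; have := key _ _ e2; have := key _ _ e3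
  have := key _ _ e4; have := key _ _ e5; have := key _ _ e6
  have := e1.ne; have := e2.ne; have := e3.ne
  have := e4.ne; have := e5.ne; have := e6.ne
  grind

lemma lt_of_adj_clique {V : Type*} [Fintype V] {G : SimpleGraph V} {m : ℕ}
    (hmax : MaxInFamily m G) {x : V → ℝ} (hx : ∀ v, 0 < x v) (hρ : 0 < specRad G)
    (heig : G.adjMatrix ℝ *ᵥ x = specRad G • x) {u a b c w : V}
    (hW : ∀ p ∈ Wset G u, ∀ q ∈ Wset G u, ∀ r ∈ Wset G u, G.Adj p q → G.Adj p r → q = r)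
    (hua : G.Adj u a) (hub : G.Adj u b) (huc : G.Adj u c) (hab : G.Adj a b) (hac : G.Adj a c)
    (hbc : G.Adj b c) (hw : w ∈ Wset G u) (hwa : G.Adj w a) : x c < x a := by
  by_contra! hle
  obtain ⟨hG, hcard, hiso, -⟩ := hmax.1
  obtain ⟨hwu, huw⟩ := mem_Wset.1 hw
  have hwc : w ≠ c := by rintro rfl; exact huw huc
  have hwb : w ≠ b := by rintro rfl; exact huw hub
  have hnwc : ¬ G.Adj w c :=
    not_adj_of_adj_clique hG hac hua.symm hab huc.symm hub hbc.ne' hwu hwb hwa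
  have hkeep : ∀ p q, p ≠ w → q ≠ w → G.Adj p q → (G \ edge w a ⊔ edge w c).Adj p q := by
    intro p q hp hq h
    simp only [sup_adj, sdiff_adj, edge_adj]
    grind
  have hnew : (G \ edge w a ⊔ edge w c).Adj w c := by simp [edge_adj, hwc]
  have hfree := gem_free_moved_edge hG hW hua hub huc hab hac hbc hw hwa
  set G' := G \ edge w a ⊔ edge w c with hG'
  have hsum := sum_moved_edge hG' hwa hnwc hwc
  have haw := hwa.ne'
  have hfam : InFamily m G' := by
    refine ⟨hfree, ?_, fun v => ?_, not_iso_bookS_of_clique _ (hkeep _ _ hwu.symm haw hua)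
      (hkeep _ _ hwu.symm hwb.symm hub) (hkeep _ _ hwu.symm hwc.symm huc)
      (hkeep _ _ haw hwb.symm hab) (hkeep _ _ haw hwc.symm hac)
      (hkeep _ _ hwb.symm hwc.symm hbc)⟩
    · have h := hsum fun _ _ => 1
      rw [two_mul_edgeCount, two_mul_edgeCount, hcard] at h
      have : (edgeCount G' : ℝ) = m := by linarith
      exact_mod_cast this
    · by_cases hva : v = a
      · exact ⟨b, hva ▸ hkeep _ _ haw hwb.symm hab⟩
      by_cases hvw : v = w
      · exact ⟨c, hvw ▸ hnew⟩
      obtain ⟨y, hy⟩ := hiso v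
      refine ⟨y, ?_⟩
      simp only [hG', sup_adj, sdiff_adj, edge_adj]
      grind
  have hquad : ∀ (H : SimpleGraph V) (y : V → ℝ), y ⬝ᵥ (H.adjMatrix ℝ *ᵥ y) =
      ∑ p, ∑ q, if H.Adj p q then y p * y q else 0 := by
    intro H y
    refine Finset.sum_congr rfl fun p _ => ?_
    rw [mulVec_adjMatrix_apply, Finset.mul_sum]
    simp
  let ε := x w / specRad G
  have hε : ε * specRad G = x w := div_mul_cancel₀ _ hρ.ne'
  have hε0 : 0 < ε := div_pos (hx w) hρ
  let y : V → ℝ := x + ε • Pi.single c 1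
  refine lt_irrefl _ (lt_specRad_of_inFamily hmax hfam y (specRad G) ?_)
  have hself : x ⬝ᵥ (G.adjMatrix ℝ *ᵥ Pi.single c 1) = specRad G * x c := by
    rw [dotProduct_mulVec, ← mulVec_transpose, transpose_adjMatrix, heig]
    simp
  have hyy : y ⬝ᵥ y = x ⬝ᵥ x + 2 * ε * x c + ε ^ 2 := by
    simp [y, add_dotProduct, dotProduct_add]
    ring
  have hyA : y ⬝ᵥ (G.adjMatrix ℝ *ᵥ y) = specRad G * (x ⬝ᵥ x) + 2 * ε * (specRad G * x c) := by
    simp only [y, mulVec_add, mulVec_smul, add_dotProduct, dotProduct_add, heig, hself,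
      smul_dotProduct, dotProduct_smul]
    simp
    ring
  have hyw : y w = x w := by simp [y, hwc]
  have hya : y a = x a := by simp [y, hac.ne]
  have hyc : y c = x c + ε := by simp [y]
  rw [hquad, hsum (fun p q => y p * y q), ← hquad, hyy, hyA, hyw, hya, hyc]
  nlinarith [mul_nonneg (hx w).le (sub_nonneg.2 hle), mul_pos (hx w) hε0]

lemma neighborFinset_of_clique {V : Type*} [Fintype V] {G : SimpleGraph V}
    (hG : ¬ ContainsCopy gem G) {u a b c : V} (hua : G.Adj u a) (hub : G.Adj u b)
    (huc : G.Adj u c) (hab : G.Adj a b) (hac : G.Adj a c) (hbc : G.Adj b c)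
    (hW : ∀ w ∈ Wset G u, ¬ G.Adj w a) : G.neighborFinset a = {u, b, c} := by
  ext y
  simp only [mem_neighborFinset, Finset.mem_insert, Finset.mem_singleton]
  refine ⟨fun hy => ?_, ?_⟩
  · by_contra! hne
    refine hW y (mem_Wset.2 ⟨hne.1, fun huy => ?_⟩) hy.symm
    exact not_adj_of_adj_clique hG hua hub huc hab hbc hac.ne hne.2.1 hne.2.2 huy.symm hy.symm
  · rintro (rfl | rfl | rfl)
    exacts [hua.symm, hab, hac]

theorem stmt11 {V : Type*} [Fintype V] (G : SimpleGraph V) (m : ℕ)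
    (hodd : Odd m) (hm : 23 ≤ m) (hmax : MaxInFamily m G)
    (x : V → ℝ) (hx : ∀ v, 0 < x v)
    (heig : G.adjMatrix ℝ *ᵥ x = specRad G • x)
    (u : V) (hu : ∀ v, x v ≤ x u)
    (u₁ u₂ u₃ : V) (h1 : u₁ ∈ Nplus G u) (h2 : u₂ ∈ Nplus G u) (h3 : u₃ ∈ Nplus G u)
    (h12 : G.Adj u₁ u₂) (h13 : G.Adj u₁ u₃) (h23 : G.Adj u₂ u₃)
    (hord : x u₁ ≤ x u₂ ∧ x u₂ ≤ x u₃)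
    (w : V) (hwW : w ∈ Wset G u)
    (hwadj : G.Adj w u₁ ∨ G.Adj w u₂ ∨ G.Adj w u₃) :
    (G.Adj w u₃ ∧ ¬ G.Adj w u₁ ∧ ¬ G.Adj w u₂) ∧
      x u₁ < 20 / 41 * x u ∧ x u₂ < 20 / 41 * x u := by
  have hG := hmax.1.1
  obtain ⟨hρ, hρm⟩ := specRad_bound_of_max hodd hm hmax
  have heig' : ∀ v, ∑ w, (if G.Adj v w then x w else 0) = specRad G * x v := fun v => by
    rw [← mulVec_adjMatrix_apply, heig]; rfl
  have hlt : (∑ p ∈ Wset G u, ∑ q ∈ Wset G u, if G.Adj p q then (1 : ℝ) else 0) < 4 := by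
    linarith [specRad_sq_sub_le hG hmax.1.2.1 hx heig' hu]
  have hW : ∀ p ∈ Wset G u, ∀ q ∈ Wset G u, ∀ r ∈ Wset G u, G.Adj p q → G.Adj p r → q = r := by
    intro p hp q hq r hr hpq hpr
    rcases Wset_edges_eq hlt hp hq hp hr hpq hpr with ⟨-, h⟩ | ⟨h, -⟩
    · exact h.symm
    · exact absurd h hpq.ne
  have hNplus : ∀ v ∈ Nplus G u, G.Adj u v := fun v hv => by
    simpa using (Finset.mem_sdiff.1 hv).1
  have a1 := hNplus _ h1
  have a2 := hNplus _ h2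
  have a3 := hNplus _ h3
  have hρ0 : 0 < specRad G := by linarith
  have n1 : ∀ w ∈ Wset G u, ¬ G.Adj w u₁ := fun w hw hadj =>
    (lt_of_adj_clique hmax hx hρ0 heig hW a1 a2 a3 h12 h13 h23 hw hadj).not_ge
      (hord.1.trans hord.2)
  have n2 : ∀ w ∈ Wset G u, ¬ G.Adj w u₂ := fun w hw hadj =>
    (lt_of_adj_clique hmax hx hρ0 heig hW a2 a1 a3 h12.symm h23 h13 hw hadj).not_ge hord.2
  have e1 : x u + (x u₂ + x u₃) = specRad G * x u₁ := by
    have := heig' u₁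
    rwa [← Finset.sum_filter, ← neighborFinset_eq_filter,
      neighborFinset_of_clique hG a1 a2 a3 h12 h13 h23 n1,
      Finset.sum_insert (by simp [a2.ne, a3.ne]), Finset.sum_pair h23.ne] at this
  have e2 : x u + (x u₁ + x u₃) = specRad G * x u₂ := by
    have := heig' u₂
    rwa [← Finset.sum_filter, ← neighborFinset_eq_filter,
      neighborFinset_of_clique hG a2 a1 a3 h12.symm h23 h13 n2,
      Finset.sum_insert (by simp [a1.ne, a3.ne]), Finset.sum_pair h13.ne] at this
  have e12 : x u₁ = x u₂ := by
    have : (specRad G + 1) * (x u₁ - x u₂) = 0 := by linarith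
    rcases mul_eq_zero.1 this with h | h <;> linarith
  have hlt1 : x u₁ < 20 / 41 * x u := by
    have := mul_lt_mul_of_pos_right hρ (hx u₁)
    linarith [hu u₃]
  refine ⟨⟨?_, n1 w hwW, n2 w hwW⟩, hlt1, e12 ▸ hlt1⟩
  exact (hwadj.resolve_left (n1 w hwW)).resolve_left (n2 w hwW)
end
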